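/- arXiv:1610.04977 — 2 statements merged into one kernel-verified Lean document; each statement's English description precedes it below -/
import Mathlib

section
/- With P and Q as defined (see context), the identity P(x_1, x_2, x_3, y_1, y_2, y_3, u x_1^{-1} y_1^{-1}) = Q(x_2, x_3, y_2, y_3; x_1, y_1; u, x_1^{-1} y_1^{-1}) holds identically as rational functions in x_1, x_2, x_3, y_1, y_2, y_3, u over ℂ, wherever both sides are defined. -/
/-- The explicit polynomial `P(X₁,X₂,X₃,Y₁,Y₂,Y₃,U)`. -/
noncomputable def Ppoly (X1 X2 X3 Y1 Y2 Y3 U : ℂ) : ℂ :=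
  1 - X1 * X2 * X3 * Y1 * Y2 * Y3 * (X1⁻¹ + X2⁻¹ + X3⁻¹) * (Y1⁻¹ + Y2⁻¹ + Y3⁻¹) * U ^ 2
    + X1 * X2 * X3 * Y1 * Y2 * Y3 *
        ((X1⁻¹ + X2⁻¹ + X3⁻¹) * (X1 + X2 + X3) + (Y1⁻¹ + Y2⁻¹ + Y3⁻¹) * (Y1 + Y2 + Y3) - 2) *
        U ^ 3
    - X1 * X2 * X3 * Y1 * Y2 * Y3 * (X1 + X2 + X3) * (Y1 + Y2 + Y3) * U ^ 4
    + (X1 * X2 * X3 * Y1 * Y2 * Y3) ^ 2 * U ^ 6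

/-- The rational function `Q(X₂,X₃,Y₂,Y₃;X₁,Y₁;U,V)`. -/
noncomputable def Qfun (X2 X3 Y2 Y3 X1 Y1 U V : ℂ) : ℂ :=
  (1 + (U * V * X2 * Y2 / (1 - U * V * X2 * Y2) * ((1 - U * X3 * X1⁻¹) / (1 - X3 * X2⁻¹)) *
          ((1 - U * Y3 * Y1⁻¹) / (1 - Y3 * Y2⁻¹))
        + U * V * X2 * Y3 / (1 - U * V * X2 * Y3) * ((1 - U * X3 * X1⁻¹) / (1 - X3 * X2⁻¹)) *
          ((1 - U * Y2 * Y1⁻¹) / (1 - Y2 * Y3⁻¹))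
        + U * V * X3 * Y2 / (1 - U * V * X3 * Y2) * ((1 - U * X2 * X1⁻¹) / (1 - X2 * X3⁻¹)) *
          ((1 - U * Y3 * Y1⁻¹) / (1 - Y3 * Y2⁻¹))
        + U * V * X3 * Y3 / (1 - U * V * X3 * Y3) * ((1 - U * X2 * X1⁻¹) / (1 - X2 * X3⁻¹)) *
          ((1 - U * Y2 * Y1⁻¹) / (1 - Y2 * Y3⁻¹))) *
      (1 - U * V⁻¹ * X1⁻¹ * Y1⁻¹)) *
    (1 - U * V * X2 * Y2) * (1 - U * V * X2 * Y3) * (1 - U * V * X3 * Y2) * (1 - U * V * X3 * Y3)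

/-- All denominators occurring in `Q(X₂,X₃,Y₂,Y₃;X₁,Y₁;U,V)` are nonzero
("`Q` is defined at this point"). -/
def QDef (X2 X3 Y2 Y3 X1 Y1 U V : ℂ) : Prop :=
  X1 ≠ 0 ∧ Y1 ≠ 0 ∧ X2 ≠ 0 ∧ X3 ≠ 0 ∧ Y2 ≠ 0 ∧ Y3 ≠ 0 ∧ V ≠ 0 ∧
    1 - U * V * X2 * Y2 ≠ 0 ∧ 1 - U * V * X2 * Y3 ≠ 0 ∧
    1 - U * V * X3 * Y2 ≠ 0 ∧ 1 - U * V * X3 * Y3 ≠ 0 ∧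
    1 - X3 * X2⁻¹ ≠ 0 ∧ 1 - X2 * X3⁻¹ ≠ 0 ∧ 1 - Y3 * Y2⁻¹ ≠ 0 ∧ 1 - Y2 * Y3⁻¹ ≠ 0

/-- Clearing the four Euler factors. -/
theorem clear_aux (n1 n2 n3 n4 p1 p2 p3 p4 q1 q2 q3 q4 w D1 D2 D3 D4 : ℂ)
    (h1 : D1 ≠ 0) (h2 : D2 ≠ 0) (h3 : D3 ≠ 0) (h4 : D4 ≠ 0) :
    (1 + (n1 / D1 * p1 * q1 + n2 / D2 * p2 * q2 + n3 / D3 * p3 * q3 + n4 / D4 * p4 * q4) * w) *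
      D1 * D2 * D3 * D4 =
    D1 * D2 * D3 * D4 + (n1 * p1 * q1 * (D2 * D3 * D4) + n2 * p2 * q2 * (D1 * D3 * D4)
      + n3 * p3 * q3 * (D1 * D2 * D4) + n4 * p4 * q4 * (D1 * D2 * D3)) * w := by
  field_simp

/-- The identity in the scaled variables `a = x₂/x₁`, `b = x₃/x₁`, `c = y₂/y₁`, `d = y₃/y₁`. -/
theorem scaled_identity (a b c d u : ℂ) (hab : a - b ≠ 0) (hcd : c - d ≠ 0)
    (h1 : 1 - u * a * c ≠ 0) (h2 : 1 - u * a * d ≠ 0)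
    (h3 : 1 - u * b * c ≠ 0) (h4 : 1 - u * b * d ≠ 0) :
    1 - (a * b + a + b) * (c * d + c + d) * u ^ 2
      + ((a * b + a + b) * (1 + a + b) * (c * d) + (c * d + c + d) * (1 + c + d) * (a * b)
          - 2 * (a * b * c * d)) * u ^ 3
      - a * b * c * d * (1 + a + b) * (1 + c + d) * u ^ 4 + (a * b * c * d) ^ 2 * u ^ 6 =
    (1 + (u * a * c / (1 - u * a * c) * ((1 - u * b) * (a / (a - b))) * ((1 - u * d) * (c / (c - d)))
        + u * a * d / (1 - u * a * d) * ((1 - u * b) * (a / (a - b))) * ((1 - u * c) * (-d / (c - d)))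
        + u * b * c / (1 - u * b * c) * ((1 - u * a) * (-b / (a - b))) * ((1 - u * d) * (c / (c - d)))
        + u * b * d / (1 - u * b * d) * ((1 - u * a) * (-b / (a - b))) *
            ((1 - u * c) * (-d / (c - d)))) * (1 - u)) *
      (1 - u * a * c) * (1 - u * a * d) * (1 - u * b * c) * (1 - u * b * d) := by
  rw [clear_aux _ _ _ _ _ _ _ _ _ _ _ _ _ _ _ _ _ h1 h2 h3 h4]
  clear h1 h2 h3 h4
  field_simp
  ring

/-- Rewriting of the quotients `1 / (1 - q/p)`. -/
theorem frac_aux (t p q : ℂ) (hp : p ≠ 0) (hpq : p - q ≠ 0) :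
    t / (1 - q * p⁻¹) = t * (p / (p - q)) := by
  have : 1 - q * p⁻¹ = (p - q) / p := by field_simp
  rw [this]
  field_simp

/-- the rational-function identity
`P(x₁,x₂,x₃,y₁,y₂,y₃, u x₁⁻¹ y₁⁻¹) = Q(x₂,x₃,y₂,y₃; x₁,y₁; u, x₁⁻¹y₁⁻¹)`,
wherever both sides are defined. -/
theorem stmt_11 (x1 x2 x3 y1 y2 y3 u : ℂ)
    (hx1 : x1 ≠ 0) (hx2 : x2 ≠ 0) (hx3 : x3 ≠ 0)
    (hy1 : y1 ≠ 0) (hy2 : y2 ≠ 0) (hy3 : y3 ≠ 0)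
    (hQ : QDef x2 x3 y2 y3 x1 y1 u (x1⁻¹ * y1⁻¹)) :
    Ppoly x1 x2 x3 y1 y2 y3 (u * x1⁻¹ * y1⁻¹) =
      Qfun x2 x3 y2 y3 x1 y1 u (x1⁻¹ * y1⁻¹) := by
  obtain ⟨-, -, -, -, -, -, -, h1, h2, h3, h4, h5, -, h6, -⟩ := hQ
  obtain ⟨a, rfl⟩ : ∃ a, x2 = a * x1 := ⟨x2 / x1, by field_simp⟩
  obtain ⟨b, rfl⟩ : ∃ a, x3 = a * x1 := ⟨x3 / x1, by field_simp⟩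
  obtain ⟨c, rfl⟩ : ∃ a, y2 = a * y1 := ⟨y2 / y1, by field_simp⟩
  obtain ⟨d, rfl⟩ : ∃ a, y3 = a * y1 := ⟨y3 / y1, by field_simp⟩
  have ha := left_ne_zero_of_mul hx2
  have hb := left_ne_zero_of_mul hx3
  have hc := left_ne_zero_of_mul hy2
  have hd := left_ne_zero_of_mul hy3
  have hm : ∀ p q : ℂ, u * (x1⁻¹ * y1⁻¹) * (p * x1) * (q * y1) = u * p * q := by
    intro p q
    field_simp
  have hx : ∀ p q : ℂ, (p * x1) * (q * x1)⁻¹ = p * q⁻¹ := by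
    intro p q
    rw [mul_inv]
    field_simp
  have hy : ∀ p q : ℂ, (p * y1) * (q * y1)⁻¹ = p * q⁻¹ := by
    intro p q
    rw [mul_inv]
    field_simp
  have hu : ∀ p : ℂ, u * (p * x1) * x1⁻¹ = u * p := by
    intro p
    field_simp
  have hv : ∀ p : ℂ, u * (p * y1) * y1⁻¹ = u * p := by
    intro p
    field_simp
  have hw : u * (x1⁻¹ * y1⁻¹)⁻¹ * x1⁻¹ * y1⁻¹ = u := by
    field_simp
  rw [hm] at h1 h2 h3 h4
  rw [hx] at h5
  rw [hy] at h6
  have hab : a - b ≠ 0 := by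
    intro h
    apply h5
    rw [← sub_eq_zero.mp h, mul_inv_cancel₀ ha, sub_self]
  have hcd : c - d ≠ 0 := by
    intro h
    apply h6
    rw [← sub_eq_zero.mp h, mul_inv_cancel₀ hc, sub_self]
  have hba : b - a ≠ 0 := by
    rw [← neg_sub]
    exact neg_ne_zero.mpr hab
  have hdc : d - c ≠ 0 := by
    rw [← neg_sub]
    exact neg_ne_zero.mpr hcd
  have e1 : b / (b - a) = -b / (a - b) := by
    rw [← neg_sub a b, div_neg, neg_div]
  have e2 : d / (d - c) = -d / (c - d) := by
    rw [← neg_sub c d, div_neg, neg_div]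
  unfold Ppoly Qfun
  simp only [hm, hx, hy, hu, hv, hw]
  simp only [frac_aux _ a b ha hab, frac_aux _ b a hb hba, frac_aux _ c d hc hcd,
    frac_aux _ d c hd hdc, e1, e2]
  rw [← scaled_identity a b c d u hab hcd h1 h2 h3 h4]
  field_simp
  ring
end

section
/- With Q as defined (see context), the identity Q(x_2, x_3, y_2, y_3; x_1, y_1; u, x_2^{-1} y_2^{-1}) = Q(x_1^{-1}, x_2^{-1}, y_1^{-1}, y_2^{-1}; x_3^{-1}, y_3^{-1}; u, x_2 y_2) holds identically as rational functions in x_1, x_2, x_3, y_1, y_2, y_3, u over ℂ, wherever both sides are defined. -/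
/-- Clearing the four denominators `1 - U V X Y`. -/
theorem Q_clear (b1 b2 b3 b4 d1 d2 d3 d4 A B C D w : ℂ)
    (h1 : d1 ≠ 0) (h2 : d2 ≠ 0) (h3 : d3 ≠ 0) (h4 : d4 ≠ 0) :
    (1 + (b1 / d1 * A * B + b2 / d2 * A * D + b3 / d3 * C * B + b4 / d4 * C * D) * w)
      * d1 * d2 * d3 * d4 =
    d1 * d2 * d3 * d4 + w * (b1 * A * B * (d2 * d3 * d4) + b2 * A * D * (d1 * d3 * d4)
      + b3 * C * B * (d1 * d2 * d4) + b4 * C * D * (d1 * d2 * d3)) := by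
  field_simp

/-- The symmetrised numerator as a polynomial. -/
theorem Q_sym (X Z Y T a P R : ℂ) (hX : X - Z ≠ 0) (hY : Y - T ≠ 0) :
    a * X * Y * ((1 - P * Z) * X / (X - Z)) * ((1 - R * T) * Y / (Y - T)) *
        ((1 - a * X * T) * (1 - a * Z * Y) * (1 - a * Z * T))
      + a * X * T * ((1 - P * Z) * X / (X - Z)) * (-((1 - R * Y) * T / (Y - T))) *
        ((1 - a * X * Y) * (1 - a * Z * Y) * (1 - a * Z * T))
      + a * Z * Y * (-((1 - P * X) * Z / (X - Z))) * ((1 - R * T) * Y / (Y - T)) *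
        ((1 - a * X * Y) * (1 - a * X * T) * (1 - a * Z * T))
      + a * Z * T * (-((1 - P * X) * Z / (X - Z))) * (-((1 - R * Y) * T / (Y - T))) *
        ((1 - a * X * Y) * (1 - a * X * T) * (1 - a * Z * Y)) =
    a * (X + Z - P * (X * Z)) * (Y + T - R * (Y * T))
      - a ^ 2 * (Y * T * (X ^ 2 + X * Z + Z ^ 2 - P * (X + Z) * (X * Z))
        + X * Z * (Y ^ 2 + Y * T + T ^ 2 - R * (Y + T) * (Y * T)) + X * Z * (Y * T))
      + a ^ 3 * (X * Z * Y * T) * ((X + Z - P * (X * Z)) * (Y + T - R * (Y * T))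
        + (X + Z - P * (X * Z)) * (R * (Y * T)) + P * (X * Z) * (Y + T - R * (Y * T)))
      - a ^ 4 * (X * Z * Y * T) ^ 2 := by
  field_simp
  ring

/-- Polynomial form of `Q`. -/
theorem Qfun_eq (X Z Y T X1 Y1 U V : ℂ) (h : QDef X Z Y T X1 Y1 U V) :
    Qfun X Z Y T X1 Y1 U V =
    (1 - U * V * X * Y) * (1 - U * V * X * T) * (1 - U * V * Z * Y) * (1 - U * V * Z * T)
    + (1 - U * V⁻¹ * X1⁻¹ * Y1⁻¹) *
    (U * V * (X + Z - U * X1⁻¹ * (X * Z)) * (Y + T - U * Y1⁻¹ * (Y * T))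
      - (U * V) ^ 2 * (Y * T * (X ^ 2 + X * Z + Z ^ 2 - U * X1⁻¹ * (X + Z) * (X * Z))
        + X * Z * (Y ^ 2 + Y * T + T ^ 2 - U * Y1⁻¹ * (Y + T) * (Y * T)) + X * Z * (Y * T))
      + (U * V) ^ 3 * (X * Z * Y * T) *
        ((X + Z - U * X1⁻¹ * (X * Z)) * (Y + T - U * Y1⁻¹ * (Y * T))
        + (X + Z - U * X1⁻¹ * (X * Z)) * (U * Y1⁻¹ * (Y * T))
        + U * X1⁻¹ * (X * Z) * (Y + T - U * Y1⁻¹ * (Y * T)))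
      - (U * V) ^ 4 * (X * Z * Y * T) ^ 2) := by
  obtain ⟨-, -, hX, hZ, hY, hT, -, h1, h2, h3, h4, h5, -, h7, -⟩ := h
  have hXZ : X - Z ≠ 0 := by
    intro e
    apply h5
    rw [← sub_eq_zero.mp e, mul_inv_cancel₀ hX, sub_self]
  have hYT : Y - T ≠ 0 := by
    intro e
    apply h7
    rw [← sub_eq_zero.mp e, mul_inv_cancel₀ hY, sub_self]
  have key : ∀ A B c : ℂ, A ≠ 0 → A - B ≠ 0 → c / (1 - B * A⁻¹) = c * A / (A - B) := by
    intro A B c hA hAB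
    have : 1 - B * A⁻¹ = (A - B) / A := by field_simp
    rw [this, div_div_eq_mul_div]
  have key2 : ∀ A B c : ℂ, B ≠ 0 → A - B ≠ 0 → c / (1 - A * B⁻¹) = -(c * B / (A - B)) := by
    intro A B c hB hAB
    rw [key B A c hB (by rwa [← neg_sub, neg_ne_zero]), ← neg_sub A B, div_neg]
  unfold Qfun
  rw [Q_clear _ _ _ _ _ _ _ _ _ _ _ _ _ h1 h2 h3 h4, ← Q_sym X Z Y T (U * V) _ _ hXZ hYT,
    key X Z _ hX hXZ, key Y T _ hY hYT, key2 X Z _ hZ hXZ, key2 Y T _ hT hYT]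
  ring

/-- the rational-function identity
`Q(x₂,x₃,y₂,y₃; x₁,y₁; u, x₂⁻¹y₂⁻¹) = Q(x₁⁻¹,x₂⁻¹,y₁⁻¹,y₂⁻¹; x₃⁻¹,y₃⁻¹; u, x₂y₂)`,
wherever both sides are defined. -/
theorem stmt_12 (x1 x2 x3 y1 y2 y3 u : ℂ)
    (hL : QDef x2 x3 y2 y3 x1 y1 u (x2⁻¹ * y2⁻¹))
    (hR : QDef x1⁻¹ x2⁻¹ y1⁻¹ y2⁻¹ x3⁻¹ y3⁻¹ u (x2 * y2)) :
    Qfun x2 x3 y2 y3 x1 y1 u (x2⁻¹ * y2⁻¹) =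
      Qfun x1⁻¹ x2⁻¹ y1⁻¹ y2⁻¹ x3⁻¹ y3⁻¹ u (x2 * y2) := by
  rw [Qfun_eq _ _ _ _ _ _ _ _ hL, Qfun_eq _ _ _ _ _ _ _ _ hR]
  obtain ⟨hx1, hy1, hx2, hx3, hy2, hy3, -⟩ := hL
  simp only [inv_inv, mul_inv]
  field_simp
  ring
end
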